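/- Let u_ε be a classical solution of the regularized anisotropic problem with ε ∈ (0,ε₀], satisfying |u_ε| ≤ M on Q̄_T, and suppose F satisfies the monotonicity condition F(x,u,z) ≤ F(x,v,z) whenever u ≥ v. Then for all t, τ ∈ [0,T] and all x ∈ Ω̄ one has |u_ε(t,x) − u_ε(τ,x)| ≤ K|t − τ|, where K is the constant defined in the context; that is, u_ε is Lipschitz continuous in time with Lipschitz constant K, uniformly in x and ε. -/

import Mathlib

open Set Filter MeasureTheory Metric

noncomputable section

/-- The `i`-th partial derivative of a function on Euclidean space. -/
def pd {n : ℕ} (f : EuclideanSpace ℝ (Fin n) → ℝ) (i : Fin n)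
    (x : EuclideanSpace ℝ (Fin n)) : ℝ :=
  fderiv ℝ f x (EuclideanSpace.single i 1)

/-- The gradient vector of a function on Euclidean space. -/
def gradv {n : ℕ} (f : EuclideanSpace ℝ (Fin n) → ℝ)
    (x : EuclideanSpace ℝ (Fin n)) : EuclideanSpace ℝ (Fin n) :=
  (WithLp.equiv 2 (Fin n → ℝ)).symm (fun i => pd f i x)

/-- The exterior sphere condition for a domain. -/
def ExteriorSphereCond {n : ℕ} (Ω : Set (EuclideanSpace ℝ (Fin n))) : Prop :=
  ∀ y ∈ frontier Ω, ∃ z r, 0 < r ∧ closedBall z r ∩ closure Ω = {y}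

/-- `f` is of class `C^{1+γ}` on `s` (C¹ with γ-Hölder continuous derivative). -/
def C1HolderOn {n : ℕ} (γ : ℝ) (s : Set (EuclideanSpace ℝ (Fin n)))
    (f : EuclideanSpace ℝ (Fin n) → ℝ) : Prop :=
  ContDiffOn ℝ 1 f s ∧
    ∃ C : NNReal, HolderOnWith C γ.toNNReal (fun x => fderivWithin ℝ f s x) s

/-- Classical solution of the regularized anisotropic problem
`u_t = ∑ᵢ ((u_{xᵢ}² + ε)^{pᵢ(x)/2} u_{xᵢ})_{xᵢ} + F(x, u, ∇u)` in `Q_T = (0,T) × Ω`,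
with `u = ψ` on `∂Ω × (0,T)` and `u(0,·) = u₀` in `Ω`. -/
structure IsClassicalSolAniso {n : ℕ} (Ω : Set (EuclideanSpace ℝ (Fin n))) (T : ℝ)
    (p : Fin n → EuclideanSpace ℝ (Fin n) → ℝ)
    (F : EuclideanSpace ℝ (Fin n) → ℝ → EuclideanSpace ℝ (Fin n) → ℝ)
    (ψ u₀ : EuclideanSpace ℝ (Fin n) → ℝ) (ε : ℝ)
    (u : ℝ → EuclideanSpace ℝ (Fin n) → ℝ) : Prop where
  cont : ContinuousOn (fun q : ℝ × EuclideanSpace ℝ (Fin n) => u q.1 q.2)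
      (Icc 0 T ×ˢ closure Ω)
  diff_t : ∀ t ∈ Ioo 0 T, ∀ x ∈ Ω, DifferentiableAt ℝ (fun s => u s x) t
  smooth_x : ∀ t ∈ Ioo 0 T, ∀ x ∈ Ω, ContDiffAt ℝ 2 (u t) x
  cont_ut : ContinuousOn
      (fun q : ℝ × EuclideanSpace ℝ (Fin n) => deriv (fun s => u s q.2) q.1) (Ioo 0 T ×ˢ Ω)
  cont_ux : ∀ i, ContinuousOn
      (fun q : ℝ × EuclideanSpace ℝ (Fin n) => pd (u q.1) i q.2) (Ioo 0 T ×ˢ Ω)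
  cont_uxx : ∀ i j, ContinuousOn
      (fun q : ℝ × EuclideanSpace ℝ (Fin n) => pd (fun y => pd (u q.1) j y) i q.2)
      (Ioo 0 T ×ˢ Ω)
  eqn : ∀ t ∈ Ioo 0 T, ∀ x ∈ Ω,
      deriv (fun s => u s x) t =
        (∑ i, pd (fun y => ((pd (u t) i y) ^ 2 + ε) ^ (p i y / 2) * pd (u t) i y) i x)
          + F x (u t x) (gradv (u t) x)
  bdry : ∀ t ∈ Ioo 0 T, ∀ x ∈ frontier Ω, u t x = ψ x
  init : ∀ x ∈ closure Ω, u 0 x = u₀ x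

open scoped Topology

theorem second_deriv_nonpos_of_isLocalMax {g g' : ℝ → ℝ} {d : ℝ} {a : ℝ}
    (hmax : IsLocalMax g a) (hg : ∀ᶠ s in 𝓝 a, HasDerivAt g (g' s) s)
    (hg' : HasDerivAt g' d a) : d ≤ 0 := by
  by_contra! hd
  have hderiv : deriv g =ᶠ[𝓝 a] g' := hg.mono fun s hs => hs.deriv
  have hdd : deriv (deriv g) a = d := by rw [hderiv.deriv_eq, hg'.deriv]
  have hmin : IsLocalMin g a :=
    isLocalMin_of_deriv_deriv_pos (hdd ▸ hd) hmax.deriv_eq_zero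
      hg.self_of_nhds.continuousAt
  have hconst : g =ᶠ[𝓝 a] fun _ => g a := by
    filter_upwards [hmax, hmin] with s h₁ h₂ using le_antisymm h₁ h₂
  have : deriv (deriv g) a = 0 := by
    rw [hconst.deriv.deriv_eq]
    simp
  linarith

theorem ContDiffAt.differentiableAt_pd {n : ℕ} {v : EuclideanSpace ℝ (Fin n) → ℝ}
    {x : EuclideanSpace ℝ (Fin n)} (hv : ContDiffAt ℝ 2 v x) (i : Fin n) :
    DifferentiableAt ℝ (fun y => pd v i y) x := by
  have h : ContDiffAt ℝ 1 (fderiv ℝ v) x := hv.fderiv_right (by norm_num)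
  exact (h.differentiableAt (by norm_num)).clm_apply (differentiableAt_const _)

theorem pd_pd_nonpos_of_isLocalMax {n : ℕ} {v : EuclideanSpace ℝ (Fin n) → ℝ}
    {x : EuclideanSpace ℝ (Fin n)} (hv : ContDiffAt ℝ 2 v x) (hmax : IsLocalMax v x)
    (i : Fin n) : pd (fun y => pd v i y) i x ≤ 0 := by
  set e : EuclideanSpace ℝ (Fin n) := EuclideanSpace.single i 1
  have hline : ∀ s : ℝ, HasDerivAt (fun s : ℝ => x + s • e) e s := fun s => by
    simpa using ((hasDerivAt_id s).smul_const e).const_add x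
  have hx : x + (0 : ℝ) • e = x := by simp
  have htend : Tendsto (fun s : ℝ => x + s • e) (𝓝 0) (𝓝 x) := by
    simpa [ContinuousAt] using (hline 0).continuousAt
  have hdiff : ∀ᶠ y in 𝓝 x, DifferentiableAt ℝ v y :=
    (hv.eventually (by simp)).mono fun y hy => hy.differentiableAt (by norm_num)
  refine second_deriv_nonpos_of_isLocalMax (g := fun s : ℝ => v (x + s • e))
    (g' := fun s : ℝ => pd v i (x + s • e)) (a := 0) ?_ ?_ ?_
  · have := htend.eventually hmax
    simpa [IsLocalMax, IsMaxFilter] using this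
  · filter_upwards [htend.eventually hdiff] with s hs
    exact hs.hasFDerivAt.comp_hasDerivAt s (hline s)
  · have h := (hv.differentiableAt_pd i).hasFDerivAt
    rw [← hx] at h
    have := h.comp_hasDerivAt (0 : ℝ) (hline 0)
    rw [hx] at this
    exact this

/-- Expanded form of one summand of the anisotropic operator. -/
theorem pd_flux {n : ℕ} {p q : EuclideanSpace ℝ (Fin n) → ℝ} {x : EuclideanSpace ℝ (Fin n)}
    {ε : ℝ} (hε : 0 < ε) (hp : DifferentiableAt ℝ p x) (hq : DifferentiableAt ℝ q x)
    (i : Fin n) :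
    pd (fun y => ((q y) ^ 2 + ε) ^ (p y / 2) * q y) i x =
      ((q x) ^ 2 + ε) ^ (p x / 2) * Real.log ((q x) ^ 2 + ε) * (pd p i x / 2) * q x +
        ((q x) ^ 2 + ε) ^ (p x / 2 - 1) * ((1 + p x) * (q x) ^ 2 + ε) * pd q i x := by
  have hpos : 0 < (q x) ^ 2 + ε := by positivity
  have hb : HasFDerivAt (fun y => (q y) ^ 2 + ε) ((2 * q x) • fderiv ℝ q x) x := by
    simpa using (hq.hasFDerivAt.pow 2).add_const ε
  have he : HasFDerivAt (fun y => p y / 2) ((1 / 2 : ℝ) • fderiv ℝ p x) x := by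
    simpa [div_eq_inv_mul] using hp.hasFDerivAt.const_mul (1 / 2 : ℝ)
  have h : HasFDerivAt (fun y => ((q y) ^ 2 + ε) ^ (p y / 2) * q y) _ x :=
    (hb.rpow he hpos).mul hq.hasFDerivAt
  have hsplit : ((q x) ^ 2 + ε) ^ (p x / 2) =
      ((q x) ^ 2 + ε) ^ (p x / 2 - 1) * ((q x) ^ 2 + ε) := by
    rw [← Real.rpow_add_one hpos.ne']
    ring_nf
  unfold pd
  rw [h.fderiv]
  simp only [add_apply, smul_apply, smul_eq_mul]
  rw [hsplit]
  ring

/-- At a local maximum of `v - w` the gradients of `v` and `w` agree and the anisotropic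
operator of `v` is at most that of `w`. -/
theorem aniso_le_of_isLocalMax_sub {n : ℕ} {p : Fin n → EuclideanSpace ℝ (Fin n) → ℝ}
    {v w : EuclideanSpace ℝ (Fin n) → ℝ} {x : EuclideanSpace ℝ (Fin n)} {ε : ℝ} (hε : 0 < ε)
    (hp : ∀ i, DifferentiableAt ℝ (p i) x) (hp1 : ∀ i, -1 < p i x)
    (hv : ContDiffAt ℝ 2 v x) (hw : ContDiffAt ℝ 2 w x)
    (hmax : IsLocalMax (fun y => v y - w y) x) :
    gradv v x = gradv w x ∧
      ∑ i, pd (fun y => ((pd v i y) ^ 2 + ε) ^ (p i y / 2) * pd v i y) i x ≤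
        ∑ i, pd (fun y => ((pd w i y) ^ 2 + ε) ^ (p i y / 2) * pd w i y) i x := by
  have hdv : ∀ᶠ y in 𝓝 x, DifferentiableAt ℝ v y :=
    (hv.eventually (by simp)).mono fun y hy => hy.differentiableAt (by norm_num)
  have hdw : ∀ᶠ y in 𝓝 x, DifferentiableAt ℝ w y :=
    (hw.eventually (by simp)).mono fun y hy => hy.differentiableAt (by norm_num)
  have hsub : ∀ i, (fun y => pd (fun y => v y - w y) i y) =ᶠ[𝓝 x]
      fun y => pd v i y - pd w i y := fun i => by
    filter_upwards [hdv, hdw] with y h₁ h₂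
    simp only [pd]
    rw [fderiv_fun_sub h₁ h₂]
    rfl
  have hgrad : ∀ i, pd v i x = pd w i x := fun i => by
    have h : pd (fun y => v y - w y) i x = 0 := by
      simp only [pd]
      rw [hmax.fderiv_eq_zero]
      rfl
    linarith [(hsub i).self_of_nhds]
  refine ⟨by simp only [gradv, hgrad], Finset.sum_le_sum fun i _ => ?_⟩
  have hsecond : pd (fun y => pd v i y) i x ≤ pd (fun y => pd w i y) i x := by
    have h := pd_pd_nonpos_of_isLocalMax (hv.sub hw) hmax i
    have heq : pd (fun y => pd (fun y => v y - w y) i y) i x =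
        pd (fun y => pd v i y) i x - pd (fun y => pd w i y) i x := by
      rw [pd, (hsub i).fderiv_eq,
        fderiv_fun_sub (hv.differentiableAt_pd i) (hw.differentiableAt_pd i)]
      rfl
    change pd (fun y => pd (fun y => v y - w y) i y) i x ≤ 0 at h
    linarith
  rw [pd_flux hε (hp i) (hv.differentiableAt_pd i),
    pd_flux hε (hp i) (hw.differentiableAt_pd i), hgrad i]
  have := hp1 i
  have : 0 ≤ (1 + p i x) * (pd w i x) ^ 2 + ε :=
    add_nonneg (mul_nonneg (by linarith) (sq_nonneg _)) hε.le
  gcongr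

/-- A weak maximum principle on a parabolic cylinder: positive spatial maxima may not grow. -/
theorem nonpos_of_deriv_nonpos_at_spatial_max {E : Type*} [NormedAddCommGroup E]
    [ProperSpace E] {Ω : Set E} (hΩo : IsOpen Ω) (hΩbd : Bornology.IsBounded Ω) {T : ℝ}
    {D : ℝ → E → ℝ}
    (hcont : ContinuousOn (fun q : ℝ × E => D q.1 q.2) (Icc 0 T ×ˢ closure Ω))
    (hinit : ∀ x ∈ closure Ω, D 0 x ≤ 0)
    (hbdry : ∀ t ∈ Ioc 0 T, ∀ x ∈ frontier Ω, D t x ≤ 0)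
    (hderiv : ∀ t ∈ Ioc 0 T, ∀ x ∈ Ω, 0 < D t x → IsLocalMax (D t) x →
      ∃ d ≤ 0, HasDerivAt (fun s => D s x) d t) :
    ∀ t ∈ Icc 0 T, ∀ x ∈ closure Ω, D t x ≤ 0 := by
  intro t₀ ht₀ x₀ hx₀
  by_contra! hpos
  have hT : 0 ≤ T := ht₀.1.trans ht₀.2
  obtain ⟨δ, hδ, hδD⟩ : ∃ δ : ℝ, 0 < δ ∧ δ * t₀ < D t₀ x₀ := by
    refine ⟨D t₀ x₀ / (t₀ + 1), div_pos hpos (by linarith [ht₀.1]), ?_⟩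
    have := ht₀.1
    rw [div_mul_eq_mul_div, div_lt_iff₀ (by linarith)]
    nlinarith
  have hcompact : IsCompact (Icc 0 T ×ˢ closure Ω) :=
    isCompact_Icc.prod hΩbd.isCompact_closure
  obtain ⟨⟨t, x⟩, ⟨ht, hx⟩, hmax⟩ := hcompact.exists_isMaxOn ⟨(t₀, x₀), ht₀, hx₀⟩
    (hcont.sub (continuous_const.mul continuous_fst).continuousOn :
      ContinuousOn (fun q : ℝ × E => D q.1 q.2 - δ * q.1) _)
  have hle : ∀ s ∈ Icc 0 T, ∀ y ∈ closure Ω, D s y - δ * s ≤ D t x - δ * t :=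
    fun s hs y hy => hmax (show (s, y) ∈ Icc 0 T ×ˢ closure Ω from ⟨hs, hy⟩)
  have hDpos : 0 < D t x - δ * t := by linarith [hle t₀ ht₀ x₀ hx₀]
  simp only at ht hx
  have hDpos' : 0 < D t x := by nlinarith [ht.1]
  have ht0 : 0 < t := ht.1.lt_of_ne fun h => by
    subst h
    exact absurd hDpos' (hinit x hx).not_gt
  have hxΩ : x ∈ Ω := by
    by_contra hxΩ
    exact absurd hDpos' (hbdry t ⟨ht0, ht.2⟩ x ⟨hx, by rwa [hΩo.interior_eq]⟩).not_gt
  have hloc : IsLocalMax (D t) x := by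
    filter_upwards [hΩo.mem_nhds hxΩ] with y hy
    linarith [hle t ht y (subset_closure hy)]
  obtain ⟨d, hd, hDd⟩ := hderiv t ⟨ht0, ht.2⟩ x hxΩ hDpos' hloc
  have hslope := (hasDerivAt_iff_tendsto_slope_left_right.1 hDd).1
  have hge : δ ≤ d := by
    refine ge_of_tendsto hslope ?_
    filter_upwards [Ioo_mem_nhdsLT ht0] with s hs
    have := hle s ⟨hs.1.le, hs.2.le.trans ht.2⟩ x hx
    rw [slope_comm, slope_def_field, le_div_iff₀ (by linarith [hs.2])]
    linarith
  linarith

theorem stmt16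
    (n : ℕ) (hn : 0 < n)
    (Ω : Set (EuclideanSpace ℝ (Fin n)))
    (hΩo : IsOpen Ω) (hΩconn : IsConnected Ω)
    (hΩbd : Bornology.IsBounded Ω) (hΩsph : ExteriorSphereCond Ω)
    (T : ℝ) (hT : 0 < T)
    (γ : ℝ) (hγ : γ ∈ Ioo (0:ℝ) 1)
    (p : Fin n → EuclideanSpace ℝ (Fin n) → ℝ)
    (hp : ∀ i, C1HolderOn γ (closure Ω) (p i))
    (hp1 : ∀ i, ∀ x ∈ closure Ω, -1 < p i x)
    (ε₀ : ℝ) (hε₀ : 0 < ε₀)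
    (F : EuclideanSpace ℝ (Fin n) → ℝ → EuclideanSpace ℝ (Fin n) → ℝ)
    (hF : ContinuousOn
      (fun q : EuclideanSpace ℝ (Fin n) × ℝ × EuclideanSpace ℝ (Fin n) => F q.1 q.2.1 q.2.2)
      (closure Ω ×ˢ (univ : Set (ℝ × EuclideanSpace ℝ (Fin n)))))
    (hFmono : ∀ x ∈ closure Ω, ∀ v w : ℝ, ∀ z : EuclideanSpace ℝ (Fin n),
      w ≤ v → F x v z ≤ F x w z)
    (ψ u₀ : EuclideanSpace ℝ (Fin n) → ℝ)
    (U : Set (EuclideanSpace ℝ (Fin n))) (hU : IsOpen U) (hUΩ : closure Ω ⊆ U)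
    (hu₀ : ContDiffOn ℝ 2 u₀ U)
    (hu₀ψ : ∀ x ∈ frontier Ω, u₀ x = ψ x)
    (M : ℝ) (hM : 0 < M)
    (ε : ℝ) (hε : ε ∈ Ioc (0:ℝ) ε₀)
    (u : ℝ → EuclideanSpace ℝ (Fin n) → ℝ)
    (hu : IsClassicalSolAniso Ω T p F ψ u₀ ε u)
    (hub : ∀ t ∈ Icc 0 T, ∀ x ∈ closure Ω, |u t x| ≤ M)
    (A B K : ℝ)
    (hA : IsLUB {a : ℝ | ∃ ε' ∈ Icc (0:ℝ) ε₀, ∃ x ∈ closure Ω,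
      a = |∑ i, pd (fun y => ((pd u₀ i y) ^ 2 + ε') ^ (p i y / 2) * pd u₀ i y) i x|} A)
    (hB : IsLUB {a : ℝ | ∃ x ∈ closure Ω, ∃ v ∈ Icc (-M) M,
      a = |F x v (gradv u₀ x)|} B)
    (hK : K = A + B)
    :
    ∀ t ∈ Icc 0 T, ∀ τ ∈ Icc 0 T, ∀ x ∈ closure Ω,
      |u t x - u τ x| ≤ K * |t - τ| := by
  have hε0 : 0 < ε := hε.1
  have hpd : ∀ x ∈ Ω, ∀ i, DifferentiableAt ℝ (p i) x := fun x hx i =>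
    (((hp i).1.mono subset_closure).contDiffAt (hΩo.mem_nhds hx)).differentiableAt (by norm_num)
  have hpx : ∀ x ∈ Ω, ∀ i, -1 < p i x := fun x hx i => hp1 i x (subset_closure hx)
  have hu₀x : ∀ x ∈ Ω, ContDiffAt ℝ 2 u₀ x := fun x hx =>
    hu₀.contDiffAt (hU.mem_nhds (hUΩ (subset_closure hx)))
  have hAx : ∀ x ∈ closure Ω,
      |∑ i, pd (fun y => ((pd u₀ i y) ^ 2 + ε) ^ (p i y / 2) * pd u₀ i y) i x| ≤ A :=
    fun x hx => hA.1 ⟨ε, ⟨hε0.le, hε.2⟩, x, hx, rfl⟩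
  have hBx : ∀ x ∈ closure Ω, ∀ v, |v| ≤ M → |F x v (gradv u₀ x)| ≤ B :=
    fun x hx v hv => hB.1 ⟨x, hx, v, abs_le.1 hv, rfl⟩
  have hK0 : 0 ≤ K := by
    obtain ⟨x, hx⟩ := hΩconn.nonempty
    have h₁ := (abs_nonneg _).trans (hAx x (subset_closure hx))
    have h₂ := (abs_nonneg _).trans (hBx x (subset_closure hx) 0 (by simpa using hM.le))
    linarith
  have hcont_shift : ∀ S a : ℝ, 0 ≤ a → S + a ≤ T → ContinuousOn
      (fun q : ℝ × EuclideanSpace ℝ (Fin n) => u (q.1 + a) q.2) (Icc 0 S ×ˢ closure Ω) :=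
    fun S a ha hS => hu.cont.comp
      ((continuous_fst.add continuous_const).prodMk continuous_snd).continuousOn
      fun q hq => ⟨⟨add_nonneg hq.1.1 ha, (add_le_add_left hq.1.2 a).trans hS⟩, hq.2⟩
  have hcont_u : ∀ S : ℝ, S ≤ T → ContinuousOn
      (fun q : ℝ × EuclideanSpace ℝ (Fin n) => u q.1 q.2) (Icc 0 S ×ˢ closure Ω) :=
    fun S hS => hu.cont.mono (prod_mono (Icc_subset_Icc_right hS) Subset.rfl)
  have hcont_u₀ : ∀ S : ℝ, ContinuousOn
      (fun q : ℝ × EuclideanSpace ℝ (Fin n) => u₀ q.2) (Icc 0 S ×ˢ closure Ω) :=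
    fun S => (hu₀.continuousOn.mono hUΩ).comp continuousOn_snd fun q hq => hq.2
  have hcont_K : ∀ S : ℝ, ContinuousOn
      (fun q : ℝ × EuclideanSpace ℝ (Fin n) => K * q.1) (Icc 0 S ×ˢ closure Ω) :=
    fun S => (continuous_const.mul continuous_fst).continuousOn
  have hKderiv : ∀ t : ℝ, HasDerivAt (fun s => K * s) K t := fun t => by
    simpa using (hasDerivAt_id t).const_mul K
  have hupper : ∀ t ∈ Ico 0 T, ∀ x ∈ closure Ω, u t x - u₀ x - K * t ≤ 0 := by
    intro S hS
    refine nonpos_of_deriv_nonpos_at_spatial_max hΩo hΩbd (T := S)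
      (D := fun t x => u t x - u₀ x - K * t)
      (((hcont_u S hS.2.le).sub (hcont_u₀ S)).sub (hcont_K S)) ?_ ?_ ?_ S ⟨hS.1, le_rfl⟩
    · intro x hx
      simp [hu.init x hx]
    · intro t ht x hx
      rw [hu.bdry t ⟨ht.1, ht.2.trans_lt hS.2⟩ x hx, hu₀ψ x hx]
      nlinarith [ht.1]
    · intro t ht x hx _ hmax
      have htT : t ∈ Ioo 0 T := ⟨ht.1, ht.2.trans_lt hS.2⟩
      have hmax' : IsLocalMax (fun y => u t y - u₀ y) x :=
        hmax.mono fun y hy => by simpa using hy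
      obtain ⟨hg, hL⟩ := aniso_le_of_isLocalMax_sub hε0 (hpd x hx) (hpx x hx)
        (hu.smooth_x t htT x hx) (hu₀x x hx) hmax'
      refine ⟨_, ?_, ((hu.diff_t t htT x hx).hasDerivAt.sub_const (u₀ x)).sub (hKderiv t)⟩
      have hF' := le_of_abs_le (hBx x (subset_closure hx) _
        (hub t (Ioo_subset_Icc_self htT) x (subset_closure hx)))
      have hA' := le_of_abs_le (hAx x (subset_closure hx))
      rw [hu.eqn t htT x hx, hg]
      linarith
  have hlower : ∀ t ∈ Ico 0 T, ∀ x ∈ closure Ω, u₀ x - u t x - K * t ≤ 0 := by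
    intro S hS
    refine nonpos_of_deriv_nonpos_at_spatial_max hΩo hΩbd (T := S)
      (D := fun t x => u₀ x - u t x - K * t)
      (((hcont_u₀ S).sub (hcont_u S hS.2.le)).sub (hcont_K S)) ?_ ?_ ?_ S ⟨hS.1, le_rfl⟩
    · intro x hx
      simp [hu.init x hx]
    · intro t ht x hx
      rw [hu.bdry t ⟨ht.1, ht.2.trans_lt hS.2⟩ x hx, hu₀ψ x hx]
      nlinarith [ht.1]
    · intro t ht x hx _ hmax
      have htT : t ∈ Ioo 0 T := ⟨ht.1, ht.2.trans_lt hS.2⟩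
      have hmax' : IsLocalMax (fun y => u₀ y - u t y) x :=
        hmax.mono fun y hy => by simpa using hy
      obtain ⟨hg, hL⟩ := aniso_le_of_isLocalMax_sub hε0 (hpd x hx) (hpx x hx)
        (hu₀x x hx) (hu.smooth_x t htT x hx) hmax'
      refine ⟨_, ?_, ((hu.diff_t t htT x hx).hasDerivAt.const_sub (u₀ x)).sub (hKderiv t)⟩
      have hF' := neg_le_of_abs_le (hBx x (subset_closure hx) _
        (hub t (Ioo_subset_Icc_self htT) x (subset_closure hx)))
      have hA' := neg_le_of_abs_le (hAx x (subset_closure hx))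
      rw [hu.eqn t htT x hx, ← hg]
      linarith
  have hshift : ∀ a b c S : ℝ, 0 ≤ a → 0 ≤ b → 0 ≤ c → 0 ≤ S → S + a < T → S + b < T →
      (∀ x ∈ closure Ω, u a x - u b x - c ≤ 0) →
      ∀ x ∈ closure Ω, u (S + a) x - u (S + b) x - c ≤ 0 := by
    intro a b c S ha hb hc hS hSa hSb h0
    refine nonpos_of_deriv_nonpos_at_spatial_max hΩo hΩbd (T := S)
      (D := fun t x => u (t + a) x - u (t + b) x - c)
      (((hcont_shift S a ha hSa.le).sub (hcont_shift S b hb hSb.le)).sub continuousOn_const)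
      ?_ ?_ ?_ S ⟨hS, le_rfl⟩
    · simpa using h0
    · intro t ht x hx
      rw [hu.bdry (t + a) ⟨by linarith [ht.1], by linarith [ht.2]⟩ x hx,
        hu.bdry (t + b) ⟨by linarith [ht.1], by linarith [ht.2]⟩ x hx]
      linarith
    · intro t ht x hx hpos hmax
      have hta : t + a ∈ Ioo 0 T := ⟨by linarith [ht.1], by linarith [ht.2]⟩
      have htb : t + b ∈ Ioo 0 T := ⟨by linarith [ht.1], by linarith [ht.2]⟩
      have hmax' : IsLocalMax (fun y => u (t + a) y - u (t + b) y) x :=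
        hmax.mono fun y hy => by simpa using hy
      obtain ⟨hg, hL⟩ := aniso_le_of_isLocalMax_sub hε0 (hpd x hx) (hpx x hx)
        (hu.smooth_x _ hta x hx) (hu.smooth_x _ htb x hx) hmax'
      refine ⟨_, ?_, (((hu.diff_t _ hta x hx).hasDerivAt.comp_add_const t a).sub
        ((hu.diff_t _ htb x hx).hasDerivAt.comp_add_const t b)).sub_const c⟩
      have hF' := hFmono x (subset_closure hx) (u (t + a) x) (u (t + b) x)
        (gradv (u (t + b)) x) (by linarith)
      rw [hu.eqn _ hta x hx, hu.eqn _ htb x hx, hg]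
      linarith
  have hopen : ∀ x ∈ closure Ω, ∀ t τ : ℝ, 0 ≤ t → t ≤ τ → τ < T →
      |u t x - u τ x| ≤ K * (τ - t) := by
    intro x hx t τ ht htτ hτ
    have hh : τ - t ∈ Ico 0 T := ⟨by linarith, by linarith⟩
    have hc : 0 ≤ K * (τ - t) := mul_nonneg hK0 hh.1
    have h₁ := hshift (τ - t) 0 _ t hh.1 le_rfl hc ht (by linarith) (by linarith)
      (fun y hy => by rw [hu.init y hy]; exact hupper _ hh y hy) x hx
    have h₂ := hshift 0 (τ - t) _ t le_rfl hh.1 hc ht (by linarith) (by linarith)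
      (fun y hy => by rw [hu.init y hy]; exact hlower _ hh y hy) x hx
    rw [add_zero, add_sub_cancel] at h₁ h₂
    rw [abs_le]
    constructor <;> linarith
  have hle : ∀ x ∈ closure Ω, ∀ t τ : ℝ, 0 ≤ t → t ≤ τ → τ ≤ T →
      |u t x - u τ x| ≤ K * (τ - t) := by
    intro x hx t τ ht htτ hτ
    rcases htτ.eq_or_lt with rfl | hlt
    · simp
    have hux : ContinuousWithinAt (fun s => u s x) (Iio τ) τ := by
      have h : ContinuousOn (fun s => u s x) (Icc 0 T) :=
        hu.cont.comp (continuous_id.prodMk continuous_const).continuousOn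
          fun s hs => ⟨hs, hx⟩
      refine (h τ ⟨ht.trans htτ, hτ⟩).mono_of_mem_nhdsWithin ?_
      filter_upwards [Ioo_mem_nhdsLT hlt] with s hs
      exact ⟨ht.trans hs.1.le, hs.2.le.trans hτ⟩
    have hK' : Tendsto (fun s => K * (s - t)) (𝓝[<] τ) (𝓝 (K * (τ - t))) :=
      ((continuous_const.mul (continuous_id.sub continuous_const)).tendsto τ).mono_left
        nhdsWithin_le_nhds
    refine le_of_tendsto_of_tendsto (hux.tendsto.const_sub (u t x)).abs hK' ?_
    filter_upwards [Ioo_mem_nhdsLT hlt] with s hs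
    exact hopen x hx t s ht hs.1.le (hs.2.trans_le hτ)
  intro t ht τ hτ x hx
  rcases le_total t τ with h | h
  · rw [abs_sub_comm t τ, abs_of_nonneg (sub_nonneg.2 h)]
    exact hle x hx t τ ht.1 h hτ.2
  · rw [abs_sub_comm (u t x), abs_of_nonneg (sub_nonneg.2 h)]
    exact hle x hx τ t hτ.1 h ht.2
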